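/- With Λₙ and β₁,ₙ as above (β₁,ₙ = inf_{a ∈ Λₙ} ‖a - λₙ‖_{L¹(0,L)} = (2πn(n+1)/L)·cot(nπ/(2(n+1)))), the infimum β₁,ₙ is not attained: there is no a ∈ Λₙ with ‖a - λₙ‖_{L¹(0,L)} = β₁,ₙ. -/

import Mathlib

open MeasureTheory Real Set intervalIntegral

/-- `f` is absolutely continuous on `[0,b]` with a.e. derivative `f'`. -/
def PR (b : ℝ) (f f' : ℝ → ℝ) : Prop :=
  AbsolutelyContinuousOnInterval f 0 b ∧ ∀ᵐ x, x ∈ Icc 0 b → HasDerivAt f (f' x) x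

lemma PR.mono {b c : ℝ} {f f' : ℝ → ℝ} (h : PR b f f') (hc : 0 ≤ c) (hcb : c ≤ b) : PR c f f' := by
  refine ⟨h.1.mono ?_, ?_⟩
  · rw [uIcc_of_le hc, uIcc_of_le (hc.trans hcb)]
    exact Icc_subset_Icc_right hcb
  · filter_upwards [h.2] with x hx hxm
    exact hx ⟨hxm.1, hxm.2.trans hcb⟩

lemma PR.mul {b : ℝ} {f f' g g' : ℝ → ℝ} (h : PR b f f') (k : PR b g g') :
    PR b (fun x => f x * g x) (fun x => f' x * g x + f x * g' x) := by
  refine ⟨h.1.fun_mul k.1, ?_⟩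
  filter_upwards [h.2, k.2] with x hx kx hxm
  exact (hx hxm).mul (kx hxm)

lemma PR.add {b : ℝ} {f f' g g' : ℝ → ℝ} (h : PR b f f') (k : PR b g g') :
    PR b (fun x => f x + g x) (fun x => f' x + g' x) := by
  refine ⟨h.1.fun_add k.1, ?_⟩
  filter_upwards [h.2, k.2] with x hx kx hxm
  exact (hx hxm).add (kx hxm)

lemma PR.const_mul {b : ℝ} {f f' : ℝ → ℝ} (h : PR b f f') (c : ℝ) :
    PR b (fun x => c * f x) (fun x => c * f' x) := by
  refine ⟨h.1.const_mul c, ?_⟩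
  filter_upwards [h.2] with x hx hxm
  exact (hx hxm).const_mul c

lemma PR.congr_deriv {b : ℝ} {f f' g' : ℝ → ℝ} (h : PR b f f')
    (hg : ∀ x ∈ Icc 0 b, f' x = g' x) : PR b f g' := by
  refine ⟨h.1, ?_⟩
  filter_upwards [h.2] with x hx hxm
  rw [← hg x hxm]; exact hx hxm

lemma PR.of_integral {b : ℝ} (hb : 0 ≤ b) (c : ℝ) {f : ℝ → ℝ} (hf : IntervalIntegrable f volume 0 b) :
    PR b (fun x => c + ∫ t in (0:ℝ)..x, f t) f := by
  have h0 : (0:ℝ) ∈ uIcc 0 b := left_mem_uIcc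
  constructor
  · have := hf.absolutelyContinuousOnInterval_intervalIntegral h0
    refine AbsolutelyContinuousOnInterval.fun_add ?_ this
    exact ContDiffOn.absolutelyContinuousOnInterval (by fun_prop)
  · filter_upwards [hf.ae_hasDerivAt_integral] with x hx hxm
    rw [uIcc_of_le hb] at hx
    exact (hx hxm 0 ⟨le_rfl, hb⟩).const_add c

lemma PR.comp {b : ℝ} {f f' F F' : ℝ → ℝ} (h : PR b f f')
    (hF : ∀ y, HasDerivAt F (F' y) y) (hF' : Continuous F') :
    PR b (fun x => F (f x)) (fun x => F' (f x) * f' x) := by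
  constructor
  · obtain ⟨C, hC⟩ := h.1.exists_bound
    have hcd : ContDiff ℝ 1 F := by
      rw [contDiff_one_iff_deriv]
      refine ⟨fun y => (hF y).differentiableAt, ?_⟩
      have : deriv F = F' := funext fun y => (hF y).deriv
      rwa [this]
    obtain ⟨K, hK⟩ := hcd.contDiffOn.exists_lipschitzOnWith (s := Icc (-C) C) (by decide)
      (convex_Icc _ _) isCompact_Icc
    have h1 := h.1
    unfold AbsolutelyContinuousOnInterval at h1 ⊢
    refine squeeze_zero' (g := fun E : ℕ × (ℕ → ℝ × ℝ) => (K:ℝ) * ∑ i ∈ Finset.range E.1, dist (f (E.2 i).1) (f (E.2 i).2)) ?_ ?_ (by simpa using h1.const_mul (K:ℝ))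
    · exact Filter.Eventually.of_forall fun E => Finset.sum_nonneg fun i _ => dist_nonneg
    · refine Filter.Eventually.filter_mono inf_le_right ?_
      rw [Filter.eventually_principal]
      intro E hE
      rw [Finset.mul_sum]
      refine Finset.sum_le_sum fun i hi => ?_
      have := hE.1 i hi
      exact hK.dist_le_mul _ (abs_le.1 (hC _ this.1)) _ (abs_le.1 (hC _ this.2))
  · filter_upwards [h.2] with x hx hxm
    exact (hF (f x)).comp x (hx hxm)

lemma PR.deriv_ae {b : ℝ} (hb : 0 ≤ b) {f f' : ℝ → ℝ} (h : PR b f f') :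
    deriv f =ᵐ[volume.restrict (uIoc 0 b)] f' := by
  rw [Filter.EventuallyEq, ae_restrict_iff' measurableSet_uIoc]
  filter_upwards [h.2] with x hx hxm
  rw [uIoc_of_le hb] at hxm
  exact (hx (Ioc_subset_Icc_self hxm)).deriv

lemma PR.integrable {b : ℝ} (hb : 0 ≤ b) {f f' : ℝ → ℝ} (h : PR b f f') :
    IntervalIntegrable f' volume 0 b :=
  h.1.intervalIntegrable_deriv.congr_ae (h.deriv_ae hb)

lemma PR.integral {b : ℝ} (hb : 0 ≤ b) {f f' : ℝ → ℝ} (h : PR b f f') :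
    ∫ x in (0:ℝ)..b, f' x = f b - f 0 := by
  rw [← h.1.integral_deriv_eq_sub]
  refine integral_congr_ae_restrict (h.deriv_ae hb).symm

lemma PR.continuousOn {b : ℝ} (hb : 0 ≤ b) {f f' : ℝ → ℝ} (h : PR b f f') :
    ContinuousOn f (Icc 0 b) := by
  have := h.1.continuousOn
  rwa [uIcc_of_le hb] at this

lemma PR.gronwall_aux {b : ℝ} (hb : 0 ≤ b) {f f' k : ℝ → ℝ} (h : PR b f f')
    (hk : IntervalIntegrable k volume 0 b)
    (hle : ∀ᵐ x, x ∈ Icc 0 b → f' x ≤ k x * f x) :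
    f b ≤ f 0 * exp (∫ t in (0:ℝ)..b, k t) := by
  have h1 := ((PR.of_integral hb 0 hk).const_mul (-1)).comp (F := exp) (F' := exp)
    Real.hasDerivAt_exp Real.continuous_exp
  have h2 := h.mul h1
  have h3 := h2.integral hb
  have h4 : ∫ x in (0:ℝ)..b, (f' x * exp (-1 * (0 + ∫ t in (0:ℝ)..x, k t)) +
     f x * (exp (-1 * (0 + ∫ t in (0:ℝ)..x, k t)) * (-1 * k x))) ≤ 0 := by
    rw [integral_of_le hb]
    refine integral_nonpos_of_ae ?_
    rw [Filter.EventuallyLE, ae_restrict_iff' measurableSet_Ioc]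
    filter_upwards [hle] with x hx hxm
    have := hx (Ioc_subset_Icc_self hxm)
    have he := exp_pos (-1 * (0 + ∫ t in (0:ℝ)..x, k t))
    simp only [Pi.zero_apply]
    nlinarith
  rw [h3] at h4
  simp only [integral_same, zero_add, mul_zero, exp_zero, mul_one, neg_mul, one_mul] at h4
  have he := exp_pos (∫ t in (0:ℝ)..b, k t)
  have : f b * exp (-∫ t in (0:ℝ)..b, k t) * exp (∫ t in (0:ℝ)..b, k t) ≤ f 0 * exp (∫ t in (0:ℝ)..b, k t) := by
    gcongr; linarith
  rwa [mul_assoc, ← exp_add, neg_add_cancel, exp_zero, mul_one] at this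

lemma PR.gronwall {b : ℝ} (hb : 0 ≤ b) {f f' k : ℝ → ℝ} (h : PR b f f')
    (hk : IntervalIntegrable k volume 0 b)
    (hle : ∀ᵐ x, x ∈ Icc 0 b → |f' x| ≤ k x * f x) :
    f b ≤ f 0 * exp (∫ t in (0:ℝ)..b, k t) ∧ f 0 * exp (-∫ t in (0:ℝ)..b, k t) ≤ f b := by
  constructor
  · refine h.gronwall_aux hb hk ?_
    filter_upwards [hle] with x hx hxm
    exact (le_abs_self _).trans (hx hxm)
  · have := (h.const_mul (-1)).gronwall_aux hb hk.neg ?_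
    · simp only [Pi.neg_apply, intervalIntegral.integral_neg] at this
      linarith
    · filter_upwards [hle] with x hx hxm
      have := (neg_le_abs (f' x)).trans (hx hxm)
      simp only [Pi.neg_apply]
      linarith

/-- Regularity: junk values do not occur. -/
lemma regularity {L : ℝ} (hL : 0 < L) {a u v : ℝ → ℝ} (ha : IntervalIntegrable a volume 0 L)
    (hu : ∀ x ∈ Icc (0:ℝ) L, u x = u 0 + ∫ t in (0:ℝ)..x, v t)
    (hv : ∀ x ∈ Icc (0:ℝ) L, v x = - ∫ t in (0:ℝ)..x, a t * u t) :
    IntervalIntegrable (fun t => a t * u t) volume 0 L ∧ IntervalIntegrable v volume 0 L := by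
  have hmono : ∀ {f : ℝ → ℝ} {x y : ℝ}, IntervalIntegrable f volume 0 y → 0 ≤ x → x ≤ y →
      IntervalIntegrable f volume 0 x := by
    intro f x y hf hx hxy
    refine hf.mono_set ?_
    rw [uIcc_of_le hx, uIcc_of_le (hx.trans hxy)]
    exact Icc_subset_Icc_right hxy
  -- local continuity
  have hcont : ∀ x ∈ Icc (0:ℝ) L, IntervalIntegrable v volume 0 x → ContinuousOn u (Icc 0 x) := by
    intro x hx hvx
    have := (PR.of_integral hx.1 (u 0) hvx).continuousOn hx.1
    exact this.congr fun y hy => hu y ⟨hy.1, hy.2.trans hx.2⟩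
  -- local bound
  set A := ∫ t in (0:ℝ)..L, (1 + |a t|) with hA
  have hbound : ∀ x ∈ Icc (0:ℝ) L, IntervalIntegrable v volume 0 x →
      u x ^ 2 ≤ u 0 ^ 2 * exp A := by
    intro x hx hvx
    have hau : IntervalIntegrable (fun t => a t * u t) volume 0 x := by
      refine (hmono ha hx.1 hx.2).mul_continuousOn ?_
      rw [uIcc_of_le hx.1]
      exact hcont x hx hvx
    have hU := PR.of_integral hx.1 (u 0) hvx
    have hV := PR.of_integral hx.1 0 hau
    have hD := (hU.mul hU).add (hV.mul hV)
    have hk : IntervalIntegrable (fun t => 1 + |a t|) volume 0 L :=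
      intervalIntegrable_const.add ha.abs
    have := (hD.gronwall hx.1 (hmono hk hx.1 hx.2) ?_).1
    · simp only [integral_same, add_zero, zero_add, mul_zero] at this
      rw [← hu x hx] at this
      have h2 : ∫ t in (0:ℝ)..x, (1 + |a t|) ≤ A := by
        refine integral_mono_interval le_rfl hx.1 hx.2 ?_ hk
        exact Filter.Eventually.of_forall fun t => by simp only [Pi.zero_apply]; positivity
      have h3 : u 0 * u 0 * exp (∫ t in (0:ℝ)..x, (1 + |a t|)) ≤ u 0 * u 0 * exp A := by
        gcongr
        exact mul_self_nonneg _
      nlinarith [mul_self_nonneg (∫ t in (0:ℝ)..x, a t * u t)]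
    · refine Filter.Eventually.of_forall fun t ht => ?_
      have ht' : t ∈ Icc (0:ℝ) L := ⟨ht.1, ht.2.trans hx.2⟩
      rw [← hu t ht']
      have : v t = - (0 + ∫ t in (0:ℝ)..t, a t * u t) := by rw [hv t ht', zero_add]
      generalize (0 + ∫ t in (0:ℝ)..t, a t * u t) = w at *
      rw [this]
      have e : -w * u t + u t * -w + (a t * u t * w + w * (a t * u t)) = 2 * (a t - 1) * (u t * w) := by ring
      rw [e, abs_mul, abs_mul]
      have h1 : |a t - 1| ≤ 1 + |a t| := by
        have := abs_sub (a t) 1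
        simp at this; linarith
      have h2 : 2 * |u t * w| ≤ u t * u t + w * w := by
        rw [abs_mul, ← abs_mul_abs_self (u t), ← abs_mul_abs_self w]
        nlinarith [sq_nonneg (|u t| - |w|)]
      have h3 : (0:ℝ) ≤ |a t - 1| := abs_nonneg _
      have h4 : (0:ℝ) ≤ |u t * w| := abs_nonneg _
      rw [abs_two]
      nlinarith [mul_le_mul h1 h2 (by positivity) (by positivity)]
  -- global bound
  have hglob : ∀ x ∈ Icc (0:ℝ) L, u x ^ 2 ≤ u 0 ^ 2 * exp A := by
    intro x hx
    by_cases hvx : IntervalIntegrable v volume 0 x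
    · exact hbound x hx hvx
    · rw [hu x hx, intervalIntegral.integral_undef hvx, add_zero]
      have : 1 ≤ exp A := by
        apply one_le_exp
        refine integral_nonneg hL.le fun t _ => by positivity
      nlinarith [sq_nonneg (u 0)]
  -- measurability
  set S := {x | x ∈ Icc (0:ℝ) L ∧ IntervalIntegrable v volume 0 x} with hS
  have h0S : (0:ℝ) ∈ S := ⟨⟨le_rfl, hL.le⟩, by simp⟩
  have hSb : BddAbove S := ⟨L, fun x hx => hx.1.2⟩
  set c := sSup S with hc
  have hc0 : 0 ≤ c := le_csSup hSb h0S
  have hcL : c ≤ L := csSup_le ⟨0, h0S⟩ fun x hx => hx.1.2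
  have hm1 : ContinuousOn u (Ico 0 c) := by
    intro y hy
    obtain ⟨x, hx, hyx⟩ := exists_lt_of_lt_csSup ⟨0, h0S⟩ hy.2
    have := hcont x hx.1 hx.2 y ⟨hy.1, hyx.le⟩
    refine this.mono_of_mem_nhdsWithin ?_
    filter_upwards [self_mem_nhdsWithin, nhdsWithin_le_nhds (Iio_mem_nhds hyx)] with z hz hz2
    exact ⟨hz.1, hz2.le⟩
  have hm2 : ContinuousOn u (Ioc c L) := by
    refine (continuousOn_const (c := u 0)).congr ?_
    intro y hy
    have hy' : y ∈ Icc (0:ℝ) L := ⟨hc0.trans hy.1.le, hy.2⟩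
    rw [hu y hy', intervalIntegral.integral_undef, add_zero]
    intro hvy
    exact absurd (le_csSup hSb (show y ∈ S from ⟨hy', hvy⟩)) (not_le.2 hy.1)
  have hmeas : AEStronglyMeasurable u (volume.restrict (Ioc 0 L)) := by
    have h1 := hm1.aestronglyMeasurable (μ := volume) measurableSet_Ico
    have h2 := hm2.aestronglyMeasurable (μ := volume) measurableSet_Ioc
    have h3 : AEStronglyMeasurable u (volume.restrict ({c} : Set ℝ)) := by
      rw [Measure.restrict_singleton]; simp
    have h4 := (aestronglyMeasurable_union_iff.2 ⟨aestronglyMeasurable_union_iff.2 ⟨h1, h2⟩, h3⟩)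
    refine h4.mono_set ?_
    intro x hx
    rcases lt_trichotomy x c with h | h | h
    · exact Or.inl (Or.inl ⟨hx.1.le, h⟩)
    · exact Or.inr h
    · exact Or.inl (Or.inr ⟨h, hx.2⟩)
  have hau : IntervalIntegrable (fun t => a t * u t) volume 0 L := by
    rw [intervalIntegrable_iff_integrableOn_Ioc_of_le hL.le] at ha ⊢
    refine Integrable.mul_bdd (c := √(u 0 ^ 2 * exp A)) ha hmeas ?_
    rw [ae_restrict_iff' measurableSet_Ioc]
    refine Filter.Eventually.of_forall fun x hx => ?_
    exact Real.abs_le_sqrt (hglob x (Ioc_subset_Icc_self hx))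
  refine ⟨hau, ?_⟩
  have : ContinuousOn v (uIcc 0 L) := by
    rw [uIcc_of_le hL.le]
    refine (((PR.of_integral hL.le 0 hau).const_mul (-1)).continuousOn hL.le).congr fun x hx => ?_
    rw [hv x hx]; ring
  exact this.intervalIntegrable

/-- The weight used for the modified angle. -/
noncomputable def hw (ω S y : ℝ) : ℝ := ω / max (cos y ^ 2) S

lemma hw_cont {ω S : ℝ} (hS : 0 < S) : Continuous (hw ω S) := by
  unfold hw
  refine continuous_const.div (by fun_prop) fun y => ?_
  exact (lt_of_lt_of_le hS (le_max_right _ _)).ne'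

lemma hw_pos {ω S : ℝ} (hω : 0 < ω) (hS : 0 < S) (y : ℝ) : 0 < hw ω S y :=
  div_pos hω (lt_of_lt_of_le hS (le_max_right _ _))

lemma hw_periodic {ω S : ℝ} : Function.Periodic (hw ω S) π := by
  intro y
  simp [hw, cos_add_pi]

lemma hw_integral {ω s : ℝ} (hs0 : 0 < s) (hs1 : s < π / 2) :
    ∫ y in (0:ℝ)..π, hw ω (sin s ^ 2) y = 2 * ω * cot s + 2 * s * ω / sin s ^ 2 := by
  have hsin : 0 < sin s := sin_pos_of_pos_of_lt_pi hs0 (by linarith [pi_pos])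
  have hS : 0 < sin s ^ 2 := by positivity
  have hint : ∀ p q, IntervalIntegrable (hw ω (sin s ^ 2)) volume p q := fun p q =>
    (hw_cont hS).intervalIntegrable p q
  rw [← integral_add_adjacent_intervals (hint 0 (π/2 - s)) (hint (π/2 - s) π),
    ← integral_add_adjacent_intervals (hint (π/2 - s) (π/2 + s)) (hint (π/2 + s) π)]
  have e1 : ∫ y in (0:ℝ)..(π/2 - s), hw ω (sin s ^ 2) y = ω * cot s := by
    have hd : ∀ y ∈ uIcc 0 (π/2 - s), HasDerivAt (fun y => ω * tan y) (hw ω (sin s ^ 2) y) y := by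
      intro y hy
      rw [uIcc_of_le (by linarith)] at hy
      have hc : sin s ≤ cos y := by
        rw [← cos_pi_div_two_sub]
        exact cos_le_cos_of_nonneg_of_le_pi hy.1 (by linarith) hy.2
      have hm : max (cos y ^ 2) (sin s ^ 2) = cos y ^ 2 := max_eq_left (by gcongr)
      have := (hasDerivAt_tan (x := y) (by linarith)).const_mul ω
      rw [hw, hm]
      simpa [div_eq_mul_inv] using this
    rw [integral_eq_sub_of_hasDerivAt hd (hint _ _)]
    simp only [tan_zero, mul_zero, sub_zero]
    rw [tan_eq_sin_div_cos, sin_pi_div_two_sub, cos_pi_div_two_sub, cot_eq_cos_div_sin]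
  have e3 : ∫ y in (π/2 + s)..π, hw ω (sin s ^ 2) y = ω * cot s := by
    have hd : ∀ y ∈ uIcc (π/2 + s) π, HasDerivAt (fun y => ω * tan y) (hw ω (sin s ^ 2) y) y := by
      intro y hy
      rw [uIcc_of_le (by linarith)] at hy
      have hc : cos y ≤ - sin s := by
        rw [← cos_add_pi_div_two, add_comm]
        exact cos_le_cos_of_nonneg_of_le_pi (by linarith) (by linarith [hy.2]) hy.1
      have hm : max (cos y ^ 2) (sin s ^ 2) = cos y ^ 2 := max_eq_left (by nlinarith)
      have := (hasDerivAt_tan (x := y) (by linarith)).const_mul ω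
      rw [hw, hm]
      simpa [div_eq_mul_inv] using this
    rw [integral_eq_sub_of_hasDerivAt hd (hint _ _)]
    simp only [tan_pi, mul_zero, zero_sub]
    rw [tan_eq_sin_div_cos, add_comm, sin_add_pi_div_two, cos_add_pi_div_two, cot_eq_cos_div_sin]
    ring
  have e2 : ∫ y in (π/2 - s)..(π/2 + s), hw ω (sin s ^ 2) y = 2 * s * ω / sin s ^ 2 := by
    have : ∀ y ∈ uIcc (π/2 - s) (π/2 + s), hw ω (sin s ^ 2) y = ω / sin s ^ 2 := by
      intro y hy
      rw [uIcc_of_le (by linarith)] at hy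
      have h1 : cos y ≤ sin s := by
        rw [← cos_pi_div_two_sub]
        exact cos_le_cos_of_nonneg_of_le_pi (by linarith) (by linarith [hy.2]) hy.1
      have h2 : - sin s ≤ cos y := by
        rw [← cos_add_pi_div_two, add_comm]
        exact cos_le_cos_of_nonneg_of_le_pi (by linarith [hy.1]) (by linarith) hy.2
      have hm : max (cos y ^ 2) (sin s ^ 2) = sin s ^ 2 := max_eq_right (by nlinarith)
      rw [hw, hm]
    rw [integral_congr this, intervalIntegral.integral_const, smul_eq_mul]
    ring
  rw [e1, e2, e3]; ring

lemma hw_ineq {ω S a y : ℝ} (hω : 0 < ω) (hS : 0 < S) (ha : ω ^ 2 ≤ a) :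
    hw ω S y * (a * cos y ^ 2 / ω + ω * sin y ^ 2) ≤ a + (ω ^ 2 / S - ω ^ 2) := by
  have e : sin y ^ 2 = 1 - cos y ^ 2 := sin_sq y
  rw [e, hw]
  set C := cos y ^ 2
  have hC : 0 ≤ C := sq_nonneg _
  rcases le_total S C with h | h
  · rw [max_eq_left h]
    have hC' : 0 < C := lt_of_lt_of_le hS h
    have : ω / C * (a * C / ω + ω * (1 - C)) = a + (ω ^ 2 / C - ω ^ 2) := by
      field_simp
    rw [this]
    gcongr
  · rw [max_eq_right h]
    have : ω / S * (a * C / ω + ω * (1 - C)) = (a - ω ^ 2) * (C / S) + ω ^ 2 / S := by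
      field_simp; ring
    rw [this]
    have h1 : C / S ≤ 1 := (div_le_one hS).2 h
    nlinarith

lemma hw_ineq_strict {ω S a y : ℝ} (hω : 0 < ω) (hS : 0 < S) (h : S < cos y ^ 2) :
    hw ω S y * (a * cos y ^ 2 / ω + ω * sin y ^ 2) < a + (ω ^ 2 / S - ω ^ 2) := by
  have e : sin y ^ 2 = 1 - cos y ^ 2 := sin_sq y
  rw [e, hw]
  set C := cos y ^ 2
  rw [max_eq_left h.le]
  have hC' : 0 < C := lt_trans hS h
  have : ω / C * (a * C / ω + ω * (1 - C)) = a + (ω ^ 2 / C - ω ^ 2) := by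
    field_simp
  rw [this]
  gcongr

/-- The Prüfer angle. -/
lemma prufer {L ω : ℝ} (hL : 0 < L) (hω : 0 < ω) {a U V : ℝ → ℝ}
    (ha : IntervalIntegrable a volume 0 L) (hU : PR L U V) (hV : PR L V (fun t => -(a t * U t)))
    (hV0 : V 0 = 0) (hne : ∃ x ∈ Icc (0:ℝ) L, U x ≠ 0) :
    ∃ θ : ℝ → ℝ, θ 0 = 0 ∧ PR L θ (fun t => a t * cos (θ t) ^ 2 / ω + ω * sin (θ t) ^ 2) ∧
      (∀ x ∈ Icc (0:ℝ) L, V x = 0 → sin (θ x) = 0) ∧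
      (∀ x ∈ Icc (0:ℝ) L, U x ≠ 0 → cos (θ x) ≠ 0) ∧
      (∀ᵐ x, x ∈ Icc (0:ℝ) L → U x ≠ 0) := by
  set D : ℝ → ℝ := fun x => ω ^ 2 * (U x * U x) + V x * V x with hDdef
  have hD := ((hU.mul hU).const_mul (ω^2)).add (hV.mul hV)
  have hk : IntervalIntegrable (fun t => ω + |a t| / ω) volume 0 L :=
    intervalIntegrable_const.add (ha.abs.div_const ω)
  have hmono : ∀ {f : ℝ → ℝ} {x : ℝ}, IntervalIntegrable f volume 0 L → x ∈ Icc 0 L →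
      IntervalIntegrable f volume 0 x := by
    intro f x hf hx
    refine hf.mono_set ?_
    rw [uIcc_of_le hx.1, uIcc_of_le hL.le]
    exact Icc_subset_Icc_right hx.2
  have hDg : ∀ x ∈ Icc (0:ℝ) L, _ := fun x hx =>
    ((hD.mono hx.1 hx.2).gronwall hx.1 (hmono hk hx) (by
      refine Filter.Eventually.of_forall fun t ht => ?_
      have e : ω ^ 2 * (V t * U t + U t * V t) + (-(a t * U t) * V t + V t * -(a t * U t))
        = 2 * ((ω ^ 2 - a t) / ω) * ((ω * U t) * V t) := by field_simp; ring
      rw [e, abs_mul, abs_mul]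
      have h1 : |(ω ^ 2 - a t) / ω| ≤ ω + |a t| / ω := by
        rw [abs_div, abs_of_pos hω]
        have : ω + |a t| / ω = (ω ^ 2 + |a t|) / ω := by field_simp
        rw [this]
        gcongr
        have := abs_sub (ω ^ 2) (a t)
        rwa [abs_of_nonneg (sq_nonneg ω)] at this
      have h2 : 2 * |(ω * U t) * V t| ≤ ω ^ 2 * (U t * U t) + V t * V t := by
        have : ω ^ 2 * (U t * U t) = (ω * U t) * (ω * U t) := by ring
        rw [this, abs_mul (ω * U t), ← abs_mul_abs_self (ω * U t), ← abs_mul_abs_self (V t)]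
        nlinarith [sq_nonneg (|ω * U t| - |V t|)]
      rw [abs_two]
      have h4 : (0:ℝ) ≤ |(ω * U t) * V t| := abs_nonneg _
      nlinarith [mul_le_mul h1 h2 (by positivity) (by positivity)]))
  have hU0 : U 0 ≠ 0 := by
    intro h0
    obtain ⟨x, hx, hxne⟩ := hne
    have := (hDg x hx).1
    simp only [h0, hV0, mul_zero, add_zero, zero_mul] at this
    have h1 : 0 < ω ^ 2 * (U x * U x) := by
      have := mul_self_pos.2 hxne
      positivity
    nlinarith [mul_self_nonneg (V x)]
  have hDpos : ∀ x ∈ Icc (0:ℝ) L, 0 < D x := by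
    intro x hx
    have := (hDg x hx).2
    refine lt_of_lt_of_le ?_ this
    have := mul_self_pos.2 hU0
    rw [hV0]
    positivity
  have hUc := hU.continuousOn hL.le
  have hVc := hV.continuousOn hL.le
  have hDc := hD.continuousOn hL.le
  set q : ℝ → ℝ := fun x => ω * (a x * U x ^ 2 + V x ^ 2) / D x with hq
  have hqi : IntervalIntegrable q volume 0 L := by
    have h1 : IntervalIntegrable (fun x => a x * (ω * U x ^ 2 / D x)) volume 0 L := by
      refine ha.mul_continuousOn ?_
      rw [uIcc_of_le hL.le]
      exact ((hUc.pow 2).const_mul ω).div hDc fun x hx => (hDpos x hx).ne'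
    have h2 : IntervalIntegrable (fun x => ω * V x ^ 2 / D x) volume 0 L := by
      refine ContinuousOn.intervalIntegrable ?_
      rw [uIcc_of_le hL.le]
      exact ((hVc.pow 2).const_mul ω).div hDc fun x hx => (hDpos x hx).ne'
    refine (h1.add h2).congr ?_
    intro x _
    simp only [hq]
    ring
  have hθ := PR.of_integral hL.le 0 hqi
  set θ : ℝ → ℝ := fun x => 0 + ∫ t in (0:ℝ)..x, q t with hθd
  have hθ0 : θ 0 = 0 := by simp [hθd]
  -- P vanishes
  have hP := ((hU.const_mul ω).mul (hθ.comp (F := sin) (F' := cos) Real.hasDerivAt_sin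
    Real.continuous_cos)).add (hV.mul (hθ.comp (F := cos) (F' := fun y => - sin y)
      Real.hasDerivAt_cos Real.continuous_sin.neg))
  set P : ℝ → ℝ := fun x => ω * U x * sin (θ x) + V x * cos (θ x) with hPd
  set κ : ℝ → ℝ := fun x => (ω ^ 2 - a x) * (U x * V x / D x) with hκ
  have hκi : IntervalIntegrable κ volume 0 L := by
    refine (intervalIntegrable_const.sub ha).mul_continuousOn ?_
    rw [uIcc_of_le hL.le]
    exact (hUc.mul hVc).div hDc fun x hx => (hDpos x hx).ne'
  have hP' : PR L P (fun x => κ x * P x) := by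
    refine hP.congr_deriv fun x hx => ?_
    have := (hDpos x hx).ne'
    simp only [hκ, hPd, hq]
    have hDx : D x = ω ^ 2 * (U x * U x) + V x * V x := rfl
    field_simp
    rw [hDx]
    ring
  have hPz : ∀ x ∈ Icc (0:ℝ) L, P x = 0 := by
    intro x hx
    have h1 := ((hP'.mul hP').mono hx.1 hx.2).gronwall hx.1 (hmono (hκi.abs.const_mul 2) hx) (by
      refine Filter.Eventually.of_forall fun t ht => ?_
      have e : κ t * P t * P t + P t * (κ t * P t) = 2 * κ t * (P t * P t) := by ring
      rw [e, abs_mul, abs_mul, abs_mul_self, abs_two])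
    have hP0 : P 0 = 0 := by simp [hPd, hθ0, hV0]
    have h2 := h1.1
    simp only [hP0, mul_zero, zero_mul] at h2
    exact mul_self_eq_zero.1 (le_antisymm h2 (mul_self_nonneg _))
  have hcos : ∀ x ∈ Icc (0:ℝ) L, D x * cos (θ x) ^ 2 = ω ^ 2 * U x ^ 2 := by
    intro x hx
    have h1 : V x * cos (θ x) = -(ω * U x * sin (θ x)) := by
      have := hPz x hx
      simp only [hPd] at this
      linarith
    have : D x * cos (θ x) ^ 2 = ω ^ 2 * U x ^ 2 * cos (θ x) ^ 2 + (V x * cos (θ x)) ^ 2 := by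
      simp only [hDdef]; ring
    rw [this, h1]
    have := sin_sq (θ x)
    linear_combination (ω ^ 2 * U x ^ 2) * this
  have hsin : ∀ x ∈ Icc (0:ℝ) L, D x * sin (θ x) ^ 2 = V x ^ 2 := by
    intro x hx
    have h1 := hcos x hx
    have := sin_sq (θ x)
    have h3 : D x = ω ^ 2 * (U x * U x) + V x * V x := rfl
    linear_combination (D x) * this - h1 + h3
  refine ⟨θ, hθ0, ?_, ?_, ?_, ?_⟩
  · refine hθ.congr_deriv fun x hx => ?_
    have hd := (hDpos x hx).ne'
    have h1 : cos (θ x) ^ 2 = ω ^ 2 * U x ^ 2 / D x := by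
      rw [← hcos x hx]; field_simp
    have h2 : sin (θ x) ^ 2 = V x ^ 2 / D x := by
      rw [← hsin x hx]; field_simp
    rw [h1, h2]
    simp only [hq]
    field_simp
  · intro x hx hVx
    have := hsin x hx
    rw [hVx] at this
    have hd := (hDpos x hx).ne'
    simpa [hd] using this
  · intro x hx hUx h0
    have := hcos x hx
    rw [h0] at this
    have h2 : 0 < ω ^ 2 * U x ^ 2 := by positivity
    rw [← this] at h2
    simp at h2
  · set s := {x | x ∈ Icc (0:ℝ) L ∧ U x = 0 ∧ HasDerivAt U (V x) x} with hs
    have hcount : s.Countable := by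
      have h1 := countable_setOfPred_isolated_right_within (s := s)
      refine h1.mono ?_
      intro x hx
      refine mem_sep hx ?_
      have hVx : V x ≠ 0 := by
        intro h0
        have := hDpos x hx.1
        simp [hDdef, hx.2.1, h0] at this
      have := hx.2.2.eventually_ne (c := 0) hVx
      rw [← Filter.empty_mem_iff_bot]
      have h2 : nhdsWithin x (s ∩ Ioi x) ≤ nhdsWithin x {x}ᶜ :=
        nhdsWithin_mono _ fun z hz => ne_of_gt hz.2
      filter_upwards [h2 this, self_mem_nhdsWithin] with z hz hzs
      exact hz hzs.1.2.1
    filter_upwards [hU.2, hcount.ae_notMem volume] with x hx hxs hxm h0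
    exact hxs ⟨hxm, h0, hx hxm⟩

lemma main_strict {L ω s : ℝ} (hL : 0 < L) (hω : 0 < ω) (hs0 : 0 < s) (hs1 : s < π / 2)
    (n : ℕ) (hωn : ω * L = n * π) (hsn : 2 * ((n:ℝ) + 1) * s = n * π) {a U V : ℝ → ℝ}
    (ha : IntervalIntegrable a volume 0 L) (hU : PR L U V) (hV : PR L V (fun t => -(a t * U t)))
    (hV0 : V 0 = 0) (hVL : V L = 0) (hne : ∃ x ∈ Icc (0:ℝ) L, U x ≠ 0)
    (hle : ∀ᵐ x ∂(volume.restrict (Ioc 0 L)), ω ^ 2 ≤ a x)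
    (hpos : volume.restrict (Ioc 0 L) {x | ω ^ 2 < a x} ≠ 0) :
    2 * ((n:ℝ) + 1) * ω * cot s < (∫ x in (0:ℝ)..L, a x) - ω ^ 2 * L := by
  obtain ⟨θ, hθ0, hθ, hθs, hθc, hUae⟩ := prufer hL hω ha hU hV hV0 hne
  have hsin : 0 < sin s := sin_pos_of_pos_of_lt_pi hs0 (by linarith [pi_pos])
  have hS : 0 < sin s ^ 2 := by positivity
  have hS1 : sin s ^ 2 < 1 := by
    have := cos_pos_of_mem_Ioo (x := s) ⟨by linarith, hs1⟩
    nlinarith [sin_sq_add_cos_sq s]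
  have hLm : L ∈ Icc (0:ℝ) L := ⟨hL.le, le_rfl⟩
  -- the angle exceeds n π
  have hbig : n * π < θ L := by
    have h1 := hθ.integral hL.le
    rw [hθ0, sub_zero] at h1
    rw [← h1, ← hωn]
    have h2 : ∫ x in (0:ℝ)..L, ω = ω * L := by simp [mul_comm]
    rw [← h2]
    have key : ∀ x, a x * cos (θ x) ^ 2 / ω + ω * sin (θ x) ^ 2 - ω
        = (a x - ω ^ 2) * cos (θ x) ^ 2 / ω := by
      intro x; rw [sin_sq]; field_simp; ring
    refine integral_lt_integral_of_ae_le_of_measure_setOfPred_lt_ne_zero hL.le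
      intervalIntegrable_const (hθ.integrable hL.le) ?_ ?_
    · filter_upwards [hle] with x hx
      have : 0 ≤ (a x - ω ^ 2) * cos (θ x) ^ 2 / ω := by
        have := sub_nonneg.2 hx
        positivity
      linarith [key x]
    · refine fun h0 => hpos ?_
      rw [← nonpos_iff_eq_zero, ← h0]
      refine measure_mono_ae ?_
      refine (ae_restrict_iff' measurableSet_Ioc).2 ?_
      filter_upwards [hUae] with x hx hxm hxa
      have hxm' := Ioc_subset_Icc_self hxm
      have hc := hθc x hxm' (hx hxm')
      have : 0 < (a x - ω ^ 2) * cos (θ x) ^ 2 / ω := by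
        have : 0 < a x - ω ^ 2 := sub_pos.2 hxa
        positivity
      change ω < _
      linarith [key x]
  have hbig' : ((n:ℝ) + 1) * π ≤ θ L := by
    obtain ⟨m, hm⟩ := sin_eq_zero_iff.1 (hθs L hLm hVL)
    rw [← hm] at hbig ⊢
    have h1 : (n:ℝ) < m := lt_of_mul_lt_mul_right hbig pi_pos.le
    have h2 : (n:ℤ) + 1 ≤ m := by
      have : (n:ℤ) < m := by exact_mod_cast h1
      omega
    have h3 : (n:ℝ) + 1 ≤ m := by exact_mod_cast h2
    exact mul_le_mul_of_nonneg_right h3 pi_pos.le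
  -- the modified angle
  set h := hw ω (sin s ^ 2) with hh
  have hc : Continuous h := hw_cont hS
  have hint : ∀ p q, IntervalIntegrable h volume p q := fun p q => hc.intervalIntegrable p q
  have hΦ := hθ.comp (F := fun y => ∫ t in (0:ℝ)..y, h t) (F' := h)
    (fun y => hc.integral_hasStrictDerivAt 0 y |>.hasDerivAt) hc
  have hI := hΦ.integral hL.le
  simp only [hθ0, integral_same, sub_zero] at hI
  have hlow : ((n:ℝ) + 1) * (2 * ω * cot s + 2 * s * ω / sin s ^ 2) ≤ ∫ t in (0:ℝ)..(θ L), h t := by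
    have hp := (hw_periodic (ω := ω) (S := sin s ^ 2)).intervalIntegral_add_zsmul_eq ((n:ℤ) + 1) 0 (fun p q => hint p q)
    rw [zero_add π, hw_integral hs0 hs1] at hp
    have e : (0:ℝ) + ((n:ℤ) + 1) • π = ((n:ℝ) + 1) * π := by simp
    rw [e] at hp
    have e2 : ((n:ℤ) + 1) • (2 * ω * cot s + 2 * s * ω / sin s ^ 2) = ((n:ℝ) + 1) * (2 * ω * cot s + 2 * s * ω / sin s ^ 2) := by
      rw [zsmul_eq_mul]; push_cast; ring
    rw [e2] at hp
    rw [← hp]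
    refine integral_mono_interval le_rfl (by positivity) hbig' ?_ (hint _ _)
    exact Filter.Eventually.of_forall fun t => (hw_pos hω hS t).le
  have hup : ∫ x in (0:ℝ)..L, h (θ x) * (a x * cos (θ x) ^ 2 / ω + ω * sin (θ x) ^ 2) <
      ∫ x in (0:ℝ)..L, (a x + (ω ^ 2 / sin s ^ 2 - ω ^ 2)) := by
    refine integral_lt_integral_of_ae_le_of_measure_setOfPred_lt_ne_zero hL.le
      (hΦ.integrable hL.le) (ha.add intervalIntegrable_const) ?_ ?_
    · filter_upwards [hle] with x hx
      exact hw_ineq hω hS hx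
    · have hcon : ContinuousWithinAt (fun x => cos (θ x) ^ 2) (Icc 0 L) 0 :=
        ((Real.continuous_cos.comp_continuousOn (hθ.continuousOn hL.le)).pow 2) 0 ⟨le_rfl, hL.le⟩
      have hev : ∀ᶠ x in nhdsWithin 0 (Icc 0 L), sin s ^ 2 < cos (θ x) ^ 2 := by
        refine hcon.eventually_const_lt ?_
        simpa [hθ0] using hS1
      rw [nhdsWithin_Icc_eq_nhdsGE hL] at hev
      obtain ⟨δ, hδ, hsub⟩ := mem_nhdsGE_iff_exists_Ico_subset.1 hev
      have hδ : 0 < δ := hδ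
      have hm : 0 < min δ L := lt_min hδ hL
      have hsub2 : Ioo 0 (min δ L) ⊆ {x | h (θ x) * (a x * cos (θ x) ^ 2 / ω + ω * sin (θ x) ^ 2) <
          a x + (ω ^ 2 / sin s ^ 2 - ω ^ 2)} := by
        intro x hx
        exact hw_ineq_strict hω hS (hsub ⟨hx.1.le, hx.2.trans_le (min_le_left _ _)⟩)
      refine fun h0 => ?_
      have h1 := measure_mono_null hsub2 h0
      rw [Measure.restrict_apply measurableSet_Ioo, inter_eq_left.2] at h1
      · rw [Real.volume_Ioo, ENNReal.ofReal_eq_zero] at h1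
        linarith
      · intro x hx
        exact ⟨hx.1, (hx.2.trans_le (min_le_right _ _)).le⟩
  rw [hI, intervalIntegral.integral_add ha intervalIntegrable_const, intervalIntegral.integral_const,
    smul_eq_mul, sub_zero] at hup
  have hfin := hlow.trans_lt hup
  have e3 : ((n:ℝ) + 1) * (2 * s * ω / sin s ^ 2) = L * (ω ^ 2 / sin s ^ 2) := by
    have : ((n:ℝ) + 1) * (2 * s * ω) = L * ω ^ 2 := by
      linear_combination ω * hsn - ω * hωn
    rw [← mul_div_assoc, this, mul_div_assoc]
  nlinarith

/-- the Lyapunov constant β₁,ₙ = (2πn(n+1)/L)·cot(nπ/(2(n+1))) is not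
attained: no a ∈ Λₙ satisfies ‖a - λₙ‖_{L¹(0,L)} = β₁,ₙ. -/
theorem lyapunov_constant_not_attained (L : ℝ) (hL : 0 < L) (n : ℕ) (hn : 1 ≤ n) :
    ¬ ∃ a : ℝ → ℝ,
        IntegrableOn a (Ioo 0 L) ∧
        (∀ᵐ x ∂(volume.restrict (Ioo 0 L)), (n : ℝ) ^ 2 * π ^ 2 / L ^ 2 ≤ a x) ∧
        0 < volume (Ioo 0 L ∩ {x | (n : ℝ) ^ 2 * π ^ 2 / L ^ 2 < a x}) ∧
        (∃ u v : ℝ → ℝ,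
          (∀ x ∈ Icc (0:ℝ) L, u x = u 0 + ∫ t in (0:ℝ)..x, v t) ∧
          (∀ x ∈ Icc (0:ℝ) L, v x = - ∫ t in (0:ℝ)..x, a t * u t) ∧
          v L = 0 ∧ (∃ x ∈ Icc (0:ℝ) L, u x ≠ 0)) ∧
        (∫ x in (0:ℝ)..L, |a x - (n : ℝ) ^ 2 * π ^ 2 / L ^ 2|) =
          2 * π * n * (n + 1) / L * Real.cot ((n : ℝ) * π / (2 * ((n : ℝ) + 1))) := by
  rintro ⟨a, ha, hle, hpos, ⟨u, v, hu, hv, hvL, hne⟩, heq⟩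
  have hn' : (0:ℝ) < n := by exact_mod_cast hn
  have hπ := pi_pos
  set ω : ℝ := n * π / L with hω
  have hω0 : 0 < ω := by positivity
  have e : (n : ℝ) ^ 2 * π ^ 2 / L ^ 2 = ω ^ 2 := by rw [hω]; ring
  rw [e] at hle hpos heq
  have hr : volume.restrict (Ioo 0 L) = volume.restrict (Ioc 0 L) :=
    Measure.restrict_congr_set Ioo_ae_eq_Ioc
  have ha' : IntervalIntegrable a volume 0 L := by
    rw [intervalIntegrable_iff_integrableOn_Ioc_of_le hL.le, IntegrableOn, ← hr]
    exact ha
  obtain ⟨hau, hvi⟩ := regularity hL ha' hu hv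
  have hU := PR.of_integral hL.le (u 0) hvi
  have hV := (PR.of_integral hL.le 0 hau).const_mul (-1)
  set U : ℝ → ℝ := fun x => u 0 + ∫ t in (0:ℝ)..x, v t
  set V : ℝ → ℝ := fun x => -1 * (0 + ∫ t in (0:ℝ)..x, a t * u t) with hVd
  have hvV : ∀ x ∈ Icc (0:ℝ) L, v x = V x := fun x hx => by rw [hv x hx, hVd]; ring
  have hU' : PR L U V := hU.congr_deriv hvV
  have hV' : PR L V (fun t => -(a t * U t)) := hV.congr_deriv fun x hx => by
    rw [hu x hx]; ring
  have hs1 : (n : ℝ) * π / (2 * ((n : ℝ) + 1)) < π / 2 := by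
    rw [div_lt_div_iff₀ (by positivity) (by positivity)]
    nlinarith
  have := main_strict hL hω0 (s := (n : ℝ) * π / (2 * ((n : ℝ) + 1))) (by positivity) hs1 n
    (by rw [hω]; field_simp) (by field_simp) ha' hU' hV' (by simp [hVd])
    (by rw [← hvV L ⟨hL.le, le_rfl⟩, hvL])
    (by obtain ⟨x, hx, hxn⟩ := hne; exact ⟨x, hx, by rwa [hu x hx] at hxn⟩)
    (by rwa [← hr]) (by
      rw [← hr, Measure.restrict_apply' measurableSet_Ioo, inter_comm]
      exact hpos.ne')
  have h2 : ∫ x in (0:ℝ)..L, |a x - ω ^ 2| = ∫ x in (0:ℝ)..L, (a x - ω ^ 2) := by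
    refine intervalIntegral.integral_congr_ae_restrict ?_
    rw [uIoc_of_le hL.le, ← hr]
    filter_upwards [hle] with x hx
    exact abs_of_nonneg (sub_nonneg.2 hx)
  rw [h2, intervalIntegral.integral_sub ha' intervalIntegrable_const,
    intervalIntegral.integral_const, smul_eq_mul, sub_zero] at heq
  have h3 : 2 * π * n * (n + 1) / L * Real.cot ((n : ℝ) * π / (2 * ((n : ℝ) + 1))) =
    2 * ((n:ℝ) + 1) * ω * cot ((n : ℝ) * π / (2 * ((n : ℝ) + 1))) := by
    rw [hω]; ring
  rw [h3] at heq
  linarith
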